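/- arXiv:1807.06927 — 3 statements merged into one kernel-verified Lean document; each statement's English description precedes it below -/
import Mathlib

section
/- Let μ and ν be Borel probability measures on ℝ with finite second moments such that ∫x dμ(x) = ∫x dν(x) and Var(μ) < Var(ν). Then there exists a Borel probability measure η on ℝ such that μ ∗ η >₂ ν ∗ η. Moreover, if μ and ν have finite absolute moments of all orders, η can be chosen with finite absolute moments of all orders. -/
open MeasureTheory ProbabilityTheory

/-- `μ` second-order stochastically dominates `ν`. -/
def SSD (μ ν : Measure ℝ) : Prop :=
  ∀ x : ℝ, 0 ≤ ∫ t in Set.Iic x, (cdf ν t - cdf μ t)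

/-- Strict second-order stochastic dominance: `SSD` together with distinctness. -/
def StrictSSD (μ ν : Measure ℝ) : Prop := SSD μ ν ∧ μ ≠ ν

/-- All absolute moments of `μ` are finite. -/
def HasAllMoments (μ : Measure ℝ) : Prop := ∀ n : ℕ, Integrable (fun x : ℝ => |x| ^ n) μ

open scoped ENNReal
open Filter Topology

/-- Iterated convolution powers. -/
noncomputable def convPow (N : Measure ℝ) : ℕ → Measure ℝ
  | 0 => Measure.dirac 0
  | n + 1 => N.conv (convPow N n)

instance convPow_finite (N : Measure ℝ) [IsFiniteMeasure N] (n : ℕ) :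
    IsFiniteMeasure (convPow N n) := by
  induction n with
  | zero => unfold convPow; infer_instance
  | succ n ih => unfold convPow; infer_instance

lemma conv_weight (A B : Measure ℝ) [SFinite A] [SFinite B] (w : ℝ → ℝ≥0∞) (hw : Measurable w)
    (hmul : ∀ x y, w (x + y) ≤ w x * w y) :
    ∫⁻ x, w x ∂(A.conv B) ≤ (∫⁻ x, w x ∂A) * ∫⁻ x, w x ∂B := by
  rw [Measure.lintegral_conv hw]
  calc ∫⁻ x, ∫⁻ y, w (x + y) ∂B ∂A ≤ ∫⁻ x, ∫⁻ y, w x * w y ∂B ∂A :=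
        lintegral_mono fun x => lintegral_mono fun y => hmul x y
    _ = ∫⁻ x, w x * ∫⁻ y, w y ∂B ∂A := by
        congr 1; ext x; rw [lintegral_const_mul _ hw]
    _ = _ := by rw [lintegral_mul_const _ hw]

lemma convPow_weight (N : Measure ℝ) [IsFiniteMeasure N] (w : ℝ → ℝ≥0∞) (hw : Measurable w)
    (hmul : ∀ x y, w (x + y) ≤ w x * w y) (h0 : w 0 ≤ 1) (n : ℕ) :
    ∫⁻ x, w x ∂(convPow N n) ≤ (∫⁻ x, w x ∂N) ^ n := by
  induction n with
  | zero => simpa [convPow] using h0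
  | succ n ih =>
    rw [convPow, pow_succ']
    exact (conv_weight _ _ w hw hmul).trans (by gcongr)

lemma sum_weight (N : Measure ℝ) [IsFiniteMeasure N] (w : ℝ → ℝ≥0∞) (hw : Measurable w)
    (hmul : ∀ x y, w (x + y) ≤ w x * w y) (h0 : w 0 ≤ 1) (h1 : ∫⁻ x, w x ∂N < 1) :
    ∫⁻ x, w x ∂(Measure.sum (convPow N)) < ∞ := by
  rw [lintegral_sum_measure]
  refine (ENNReal.tsum_le_tsum (convPow_weight N w hw hmul h0)).trans_lt ?_
  rw [ENNReal.tsum_geometric]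
  simpa using h1

lemma sum_ge (N : Measure ℝ) [IsFiniteMeasure N] (h : ℝ → ℝ≥0∞) (hh : Measurable h) :
    ∫⁻ x, ∫⁻ y, h (x + y) ∂(Measure.sum (convPow N)) ∂N ≤ ∫⁻ x, h x ∂(Measure.sum (convPow N)) := by
  simp_rw [lintegral_sum_measure]
  rw [lintegral_tsum (fun n => by
    have : Measurable (fun x : ℝ × ℝ => h (x.1 + x.2)) := by fun_prop
    exact (Measurable.lintegral_prod_right (ν := convPow N n) this).aemeasurable)]
  have e : ∀ n, ∫⁻ x, ∫⁻ y, h (x + y) ∂(convPow N n) ∂N = ∫⁻ x, h x ∂(convPow N (n + 1)) := by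
    intro n
    rw [convPow, Measure.lintegral_conv hh]
  rw [tsum_congr e]
  exact ENNReal.tsum_comp_le_tsum_of_injective (add_left_injective 1)
    (fun n => ∫⁻ x, h x ∂(convPow N n))

lemma wt_mul (δ : ℝ) (hδ : 0 ≤ δ) (m : ℕ) (x y : ℝ) :
    ENNReal.ofReal ((1 + δ * |x + y|) ^ m) ≤
      ENNReal.ofReal ((1 + δ * |x|) ^ m) * ENNReal.ofReal ((1 + δ * |y|) ^ m) := by
  rw [← ENNReal.ofReal_mul (by positivity), ← mul_pow]
  apply ENNReal.ofReal_le_ofReal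
  gcongr
  have h1 := abs_add_le x y
  have : 0 ≤ (δ * |x|) * (δ * |y|) := by positivity
  nlinarith [mul_le_mul_of_nonneg_left h1 hδ]

lemma laplace_fin (ε δ : ℝ) (hε : 0 < ε) (hδ : 0 ≤ δ) (m : ℕ) :
    ∫⁻ x, ENNReal.ofReal ((1 + δ * |x|) ^ m) * ENNReal.ofReal (Real.exp (-ε * |x|)) < ∞ := by
  set k : ℝ := ε / (m + 2) with hk
  have hkpos : 0 < k := by positivity
  have key : ∀ a : ℝ, 0 ≤ a → ∀ x : ℝ, 1 + a * |x| ≤ (1 + a / k) * Real.exp (k * |x|) := by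
    intro a ha x
    have h1 := Real.add_one_le_exp (k * |x|)
    calc 1 + a * |x| ≤ (1 + a / k) * (k * |x| + 1) := by
          have e : (1 + a / k) * (k * |x| + 1) = 1 + a * |x| + (k * |x| + a / k) := by
            field_simp; ring
          rw [e]; have : 0 ≤ k * |x| + a / k := by positivity
          linarith
      _ ≤ _ := by gcongr
  have hb : ∀ x : ℝ, (1 + δ * |x|) ^ m * Real.exp (-ε * |x|) ≤
      ((1 + δ / k) ^ m * (1 + 1 / k) ^ 2) * (1 + x ^ 2)⁻¹ := by
    intro x
    rw [← div_eq_mul_inv, le_div_iff₀ (by positivity)]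
    have e1 : (1 + δ * |x|) ^ m ≤ ((1 + δ / k) * Real.exp (k * |x|)) ^ m := by
      have := key δ hδ x; gcongr
    have e2 : 1 + x ^ 2 ≤ ((1 + 1 / k) * Real.exp (k * |x|)) ^ 2 := by
      have := key 1 zero_le_one x
      calc 1 + x ^ 2 ≤ (1 + 1 * |x|) ^ 2 := by
            have := abs_nonneg x; nlinarith [sq_abs x]
        _ ≤ _ := by gcongr
    calc (1 + δ * |x|) ^ m * Real.exp (-ε * |x|) * (1 + x ^ 2)
        ≤ ((1 + δ / k) * Real.exp (k * |x|)) ^ m * Real.exp (-ε * |x|) *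
          ((1 + 1 / k) * Real.exp (k * |x|)) ^ 2 := by gcongr
      _ = ((1 + δ / k) ^ m * (1 + 1 / k) ^ 2) *
          (Real.exp (k * |x|) ^ (m + 2) * Real.exp (-ε * |x|)) := by
          rw [mul_pow, mul_pow, pow_add]; ring
      _ = _ := by
          rw [← Real.exp_nat_mul, ← Real.exp_add]
          have : ((m + 2 : ℕ) : ℝ) * (k * |x|) + -ε * |x| = 0 := by
            rw [hk]; push_cast; field_simp; ring
          rw [this]; simp
  have hI : Integrable (fun x : ℝ => ((1 + δ / k) ^ m * (1 + 1 / k) ^ 2) * (1 + x ^ 2)⁻¹) :=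
    integrable_inv_one_add_sq.const_mul _
  refine lt_of_le_of_lt (lintegral_mono fun x => ?_) hI.lintegral_lt_top
  rw [← ENNReal.ofReal_mul (by positivity)]
  exact ENNReal.ofReal_le_ofReal (hb x)

lemma exists_c (f : ℝ → ℝ≥0∞) (hf : Measurable f) (hfin : ∫⁻ x, f x < ∞) (b : ℝ≥0∞)
    (hb : b < ∫⁻ x, f x) : ∃ ε : ℝ, 0 < ε ∧ ∃ c : ℝ≥0∞, b < c ∧ c < ∞ ∧
      ∀ x, c * ENNReal.ofReal (Real.exp (-ε * |x|)) ≤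
        ∫⁻ w, f w * ENNReal.ofReal (Real.exp (-ε * |x - w|)) := by
  have h1 : Tendsto (fun K : ℝ => ∫⁻ x in Set.Icc (-K) K, f x) atTop (𝓝 (∫⁻ x, f x)) :=
    (aecover_Icc tendsto_neg_atTop_atBot tendsto_id).lintegral_tendsto_of_countably_generated
      hf.aemeasurable
  obtain ⟨K, hK, hK0⟩ := ((h1.eventually (lt_mem_nhds hb)).and (eventually_ge_atTop 0)).exists
  set a := ∫⁻ x in Set.Icc (-K) K, f x with ha
  have hafin : a < ∞ := lt_of_le_of_lt (setLIntegral_le_lintegral _ _) hfin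
  have h2 : Tendsto (fun ε : ℝ => ENNReal.ofReal (Real.exp (-ε * K)) * a) (𝓝[>] 0)
      (𝓝 (ENNReal.ofReal (Real.exp (-0 * K)) * a)) := by
    refine tendsto_nhdsWithin_of_tendsto_nhds ?_
    refine ENNReal.Tendsto.mul_const (ENNReal.tendsto_ofReal ?_) (Or.inr hafin.ne)
    exact Continuous.tendsto (by fun_prop) 0
  rw [neg_zero, zero_mul, Real.exp_zero, ENNReal.ofReal_one, one_mul] at h2
  obtain ⟨ε, hε, hε0⟩ := ((h2.eventually (lt_mem_nhds hK)).and self_mem_nhdsWithin).exists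
  have hε0 : 0 < ε := hε0
  refine ⟨ε, hε0, _, hε, ENNReal.mul_lt_top ENNReal.ofReal_lt_top hafin, fun x => ?_⟩
  refine le_trans ?_ (setLIntegral_le_lintegral (Set.Icc (-K) K) _)
  rw [mul_right_comm, mul_comm, ha, ← lintegral_mul_const _ hf]
  refine setLIntegral_mono (by fun_prop) fun w hw => ?_
  rw [← ENNReal.ofReal_mul (by positivity), ← Real.exp_add]
  gcongr
  have h3 : |x - w| ≤ |x| + |w| := abs_sub x w
  have h4 : |w| ≤ K := abs_le.2 hw
  nlinarith

lemma key (G : ℝ → ℝ) (hG : Measurable G) (hGint : Integrable G) (hpos : 0 < ∫ x, G x) :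
    ∃ η : Measure ℝ, IsProbabilityMeasure η ∧ (∀ s, 0 ≤ ∫ z, G (s - z) ∂η) ∧
      ((∀ m : ℕ, Integrable (fun s => |s| ^ m * G s)) →
        ∀ m : ℕ, Integrable (fun x : ℝ => |x| ^ m) η) := by
  set fp : ℝ → ℝ≥0∞ := fun x => ENNReal.ofReal (G x) with hfp
  set fm : ℝ → ℝ≥0∞ := fun x => ENNReal.ofReal (-G x) with hfm
  have mfp : Measurable fp := by fun_prop
  have mfm : Measurable fm := by fun_prop
  have ffin : ∫⁻ x, fp x < ∞ := hGint.lintegral_lt_top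
  have fmfin : ∫⁻ x, fm x < ∞ := hGint.neg.lintegral_lt_top
  have hlt : ∫⁻ x, fm x < ∫⁻ x, fp x := by
    rw [integral_eq_lintegral_pos_part_sub_lintegral_neg_part hGint] at hpos
    exact (ENNReal.toReal_lt_toReal fmfin.ne ffin.ne).1 (sub_pos.1 hpos)
  obtain ⟨ε, hε, c, hbc, hc, hcc⟩ := exists_c fp mfp ffin _ hlt
  have hc0 : c ≠ 0 := (bot_le.trans_lt hbc).ne'
  set p : ℝ → ℝ≥0∞ := fun x => ENNReal.ofReal (Real.exp (-ε * |x|)) with hp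
  have mp : Measurable p := by fun_prop
  have mden : Measurable (fun x => c⁻¹ * fm x) := by fun_prop
  set N : Measure ℝ := volume.withDensity (fun x => c⁻¹ * fm x) with hN
  have hN1 : ∀ h : ℝ → ℝ≥0∞, Measurable h → ∫⁻ x, h x ∂N = c⁻¹ * ∫⁻ x, fm x * h x := by
    intro h mh
    rw [hN, lintegral_withDensity_eq_lintegral_mul _ mden mh, ← lintegral_const_mul _ (by fun_prop)]
    simp [mul_assoc]
  have hNlt : N Set.univ < 1 := by
    have := hN1 (fun _ => 1) measurable_const
    rw [lintegral_const, one_mul] at this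
    rw [this]
    simp only [mul_one]
    rw [mul_comm, ← div_eq_mul_inv]
    exact ENNReal.div_lt_of_lt_mul (by simpa using hbc)
  have : IsFiniteMeasure N := ⟨hNlt.trans ENNReal.one_lt_top⟩
  set θ := Measure.sum (convPow N) with hθ
  have hθfin : θ Set.univ < ∞ := by
    have := sum_weight N (fun _ => 1) measurable_const (by simp) le_rfl (by simpa using hNlt)
    rwa [lintegral_const, one_mul] at this
  have : IsFiniteMeasure θ := ⟨hθfin⟩
  set ρ : Measure ℝ := volume.withDensity p with hρ
  have hρint : ∀ h : ℝ → ℝ≥0∞, Measurable h → ∫⁻ x, h x ∂ρ = ∫⁻ x, p x * h x := by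
    intro h mh
    rw [hρ, lintegral_withDensity_eq_lintegral_mul _ mp mh]; rfl
  have hρfin : ρ Set.univ < ∞ := by
    have := laplace_fin ε 0 hε le_rfl 0
    simpa [hρ, hp, withDensity_apply] using this
  have : IsFiniteMeasure ρ := ⟨hρfin⟩
  set η₀ := ρ.conv θ with hη₀
  have hη₀int : ∀ h : ℝ → ℝ≥0∞, Measurable h → ∀ s, ∫⁻ z, h (s - z) ∂η₀ =
      ∫⁻ v, (∫⁻ w, h w * p (s - v - w)) ∂θ := by
    intro h mh s
    rw [hη₀, Measure.conv_comm, Measure.lintegral_conv (by fun_prop)]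
    congr 1; ext v
    rw [hρint _ (by fun_prop)]
    rw [← lintegral_sub_left_eq_self _ (s - v)]
    congr 1; ext w
    rw [mul_comm]; congr 2; ring
  have hmain : ∀ s, ∫⁻ z, fm (s - z) ∂η₀ ≤ ∫⁻ z, fp (s - z) ∂η₀ := by
    intro s
    rw [hη₀int _ mfm, hη₀int _ mfp]
    calc ∫⁻ v, (∫⁻ w, fm w * p (s - v - w)) ∂θ
        = ∫⁻ v, c * ∫⁻ w, p (s - v - w) ∂N ∂θ := by
          congr 1; ext v
          rw [hN1 _ (by fun_prop), ← mul_assoc, ENNReal.mul_inv_cancel hc0 hc.ne, one_mul]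
      _ = c * ∫⁻ v, ∫⁻ w, p (s - v - w) ∂N ∂θ := by
          rw [lintegral_const_mul]
          have : Measurable (fun x : ℝ × ℝ => p (s - x.1 - x.2)) := by fun_prop
          exact Measurable.lintegral_prod_right (ν := N) this
      _ = c * ∫⁻ w, ∫⁻ v, p (s - (w + v)) ∂θ ∂N := by
          rw [lintegral_lintegral_swap (Measurable.aemeasurable (by fun_prop))]
          congr 1; congr 1; ext w; congr 1; ext v; congr 1; ring
      _ ≤ c * ∫⁻ v, p (s - v) ∂θ := by
          refine mul_le_mul' le_rfl ?_
          exact sum_ge N (fun x => p (s - x)) (by fun_prop)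
      _ = ∫⁻ v, c * p (s - v) ∂θ := by rw [lintegral_const_mul _ (by fun_prop)]
      _ ≤ _ := lintegral_mono fun v => hcc (s - v)
  have hη₀fin : IsFiniteMeasure η₀ := by rw [hη₀]; infer_instance
  have hη₀0 : η₀ ≠ 0 := by
    intro h0
    have h1 : ∫⁻ z, (1 : ℝ≥0∞) ∂η₀ = 0 := by rw [h0]; simp
    rw [hη₀, Measure.lintegral_conv measurable_const] at h1
    simp only [lintegral_const, one_mul] at h1
    rcases mul_eq_zero.1 h1 with h | h
    · have h2 : Measure.dirac (0 : ℝ) Set.univ ≤ θ Set.univ :=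
        Measure.le_sum (convPow N) 0 Set.univ
      rw [h] at h2; simp at h2
    · have h2 := hρint (fun _ => 1) measurable_const
      simp only [lintegral_const, one_mul, h, mul_one] at h2
      have h3 := (lintegral_eq_zero_iff mp).1 h2.symm
      obtain ⟨x, hx⟩ := h3.exists
      simp [hp, ENNReal.ofReal_eq_zero] at hx
      exact absurd hx (not_le.2 (Real.exp_pos _))
  have : NeZero η₀ := ⟨hη₀0⟩
  refine ⟨(η₀ Set.univ)⁻¹ • η₀, isProbabilityMeasureSMul, ?_, ?_⟩
  · intro s
    rw [integral_smul_measure]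
    refine smul_nonneg ENNReal.toReal_nonneg ?_
    by_cases hi : Integrable (fun z => G (s - z)) η₀
    · rw [integral_eq_lintegral_pos_part_sub_lintegral_neg_part hi, sub_nonneg]
      exact ENNReal.toReal_mono hi.lintegral_lt_top.ne (hmain s)
    · rw [integral_undef hi]
  · intro hmom m
    refine Integrable.smul_measure ?_ (by simpa using hη₀0)
    have hb : ∫⁻ x, ENNReal.ofReal ((1 + 1 * |x|) ^ m) ∂N < ∞ := by
      rw [hN1 _ (by fun_prop)]
      refine ENNReal.mul_lt_top (by simpa using hc0.bot_lt) ?_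
      have hI : Integrable (fun x => 2 ^ (m - 1) * (|G x| + |x| ^ m * |G x|)) := by
        refine (hGint.abs.add ?_).const_mul _
        refine (hmom m).abs.congr (ae_of_all _ fun x => ?_)
        simp [abs_mul]
      refine lt_of_le_of_lt (lintegral_mono fun x => ?_) hI.lintegral_lt_top
      have h1 : fm x ≤ ENNReal.ofReal |G x| := ENNReal.ofReal_le_ofReal (neg_le_abs _)
      refine (mul_le_mul_left h1 _).trans ?_
      rw [← ENNReal.ofReal_mul (by positivity)]
      refine ENNReal.ofReal_le_ofReal ?_
      have := add_pow_le (zero_le_one' ℝ) (abs_nonneg x) m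
      calc |G x| * (1 + 1 * |x|) ^ m ≤ |G x| * (2 ^ (m - 1) * (1 ^ m + |x| ^ m)) := by
            rw [one_mul]; gcongr
        _ = _ := by rw [one_pow]; ring
    have htend : Tendsto (fun δ : ℝ => ∫⁻ x, ENNReal.ofReal ((1 + δ * |x|) ^ m) ∂N) (𝓝[>] 0)
        (𝓝 (∫⁻ x, ENNReal.ofReal ((1 + 0 * |x|) ^ m) ∂N)) := by
      refine tendsto_lintegral_filter_of_dominated_convergence
        (fun x => ENNReal.ofReal ((1 + 1 * |x|) ^ m)) (Eventually.of_forall fun δ => by fun_prop)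
        ?_ hb.ne (ae_of_all _ fun x => ?_)
      · filter_upwards [Ioc_mem_nhdsGT (zero_lt_one' ℝ)] with δ hδ
        refine ae_of_all _ fun x => ?_
        have := hδ.1.le
        have := hδ.2
        gcongr
      · refine tendsto_nhdsWithin_of_tendsto_nhds (ENNReal.tendsto_ofReal ?_)
        exact Continuous.tendsto (by fun_prop) 0
    have hlim : ∫⁻ x, ENNReal.ofReal ((1 + 0 * |x|) ^ m) ∂N < 1 := by simpa using hNlt
    obtain ⟨δ, hδ1, hδ⟩ := ((htend.eventually (gt_mem_nhds hlim)).and self_mem_nhdsWithin).exists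
    have hδ : 0 < δ := hδ
    have hθw := sum_weight N (fun x => ENNReal.ofReal ((1 + δ * |x|) ^ m)) (by fun_prop)
      (wt_mul δ hδ.le m) (by simp) hδ1
    have hρw : ∫⁻ x, ENNReal.ofReal ((1 + δ * |x|) ^ m) ∂ρ < ∞ := by
      rw [hρint _ (by fun_prop)]
      have := laplace_fin ε δ hε hδ.le m
      simp_rw [mul_comm (ENNReal.ofReal ((1 + δ * |_|) ^ m))] at this
      exact this
    have hηw : ∫⁻ x, ENNReal.ofReal ((1 + δ * |x|) ^ m) ∂η₀ < ∞ :=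
      (conv_weight ρ θ _ (by fun_prop) (wt_mul δ hδ.le m)).trans_lt (ENNReal.mul_lt_top hρw hθw)
    have hIw : Integrable (fun x => (1 + δ * |x|) ^ m) η₀ := by
      refine ⟨by fun_prop, ?_⟩
      rw [hasFiniteIntegral_iff_ofReal (ae_of_all _ fun x => by positivity)]
      exact hηw
    refine (hIw.const_mul ((1 / δ) ^ m)).mono' (by fun_prop) (ae_of_all _ fun x => ?_)
    rw [Real.norm_of_nonneg (by positivity), ← mul_pow]
    gcongr
    rw [mul_add, ← mul_assoc, one_div, inv_mul_cancel₀ hδ.ne']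
    have : 0 ≤ δ⁻¹ * 1 := by positivity
    linarith

lemma gen_int (μ : Measure ℝ) [IsProbabilityMeasure μ] (F : ℝ → ℝ → ℝ) (h : ℝ → ℝ)
    (hF : Measurable (Function.uncurry F)) (hm : Measurable h) (h0 : ∀ x, 0 ≤ h x)
    (hb : ∀ t x, |F t x| ≤ h x) (hs : ∀ t x, |x| < |t| → F t x = 0)
    (hi : Integrable (fun x => h x * |x|) μ) :
    Integrable (Function.uncurry F) ((volume : Measure ℝ).prod μ) := by
  refine ⟨hF.aestronglyMeasurable, ?_⟩
  rw [hasFiniteIntegral_iff_norm, lintegral_prod_symm _ (by fun_prop)]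
  refine lt_of_le_of_lt (lintegral_mono fun x => ?_) (hi.const_mul 2).lintegral_lt_top
  calc ∫⁻ t, ENNReal.ofReal ‖Function.uncurry F (t, x)‖
      ≤ ∫⁻ t, (Set.Icc (-|x|) |x|).indicator (fun _ => ENNReal.ofReal (h x)) t := by
        refine lintegral_mono fun t => ?_
        by_cases ht : t ∈ Set.Icc (-|x|) |x|
        · rw [Set.indicator_of_mem ht]
          exact ENNReal.ofReal_le_ofReal (hb t x)
        · have : F t x = 0 := hs t x (not_le.1 fun h' => ht (abs_le.1 h'))
          simp [this]
    _ = ENNReal.ofReal (2 * (h x * |x|)) := by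
        rw [lintegral_indicator measurableSet_Icc, setLIntegral_const, Real.volume_Icc,
          ← ENNReal.ofReal_mul (h0 x)]
        congr 1; ring

/-- Centred step function. -/
noncomputable def kk (t x : ℝ) : ℝ := (if x ≤ t then 1 else 0) - (if 0 ≤ t then 1 else 0)

/-- Second order Taylor kernel. -/
noncomputable def ph (s x : ℝ) : ℝ := max (s - x) 0 - max s 0 + (if 0 ≤ s then x else 0)

lemma kk_meas : Measurable (Function.uncurry kk) := by
  unfold kk Function.uncurry
  refine Measurable.sub (Measurable.ite ?_ measurable_const measurable_const)
    (Measurable.ite ?_ measurable_const measurable_const)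
  · exact measurableSet_le measurable_snd measurable_fst
  · exact measurableSet_le measurable_const measurable_fst

lemma ph_meas : Measurable (Function.uncurry ph) := by
  unfold ph Function.uncurry
  refine Measurable.add (by fun_prop) (Measurable.ite ?_ measurable_snd measurable_const)
  exact measurableSet_le measurable_const measurable_fst

lemma kk_le (t x : ℝ) : |kk t x| ≤ 1 := by
  unfold kk; split_ifs <;> norm_num

lemma kk_zero (t x : ℝ) (h : |x| < |t|) : kk t x = 0 := by
  unfold kk
  rcases abs_cases t with ⟨h1, h2⟩ | ⟨h1, h2⟩ <;> rcases abs_lt.1 h with ⟨h3, h4⟩ <;>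
    split_ifs <;> first | (exfalso; linarith) | norm_num

lemma ph_le (t x : ℝ) : |ph t x| ≤ |x| := by
  unfold ph
  rcases abs_cases x with ⟨h1, h2⟩ | ⟨h1, h2⟩ <;> rcases max_cases (t - x) 0 with ⟨h3, h4⟩ | ⟨h3, h4⟩ <;>
  rcases max_cases t 0 with ⟨h5, h6⟩ | ⟨h5, h6⟩ <;> split_ifs <;> rw [h1, h3, h5, abs_le] <;>
  constructor <;> linarith

lemma ph_zero (t x : ℝ) (h : |x| < |t|) : ph t x = 0 := by
  unfold ph
  rcases abs_lt.1 h with ⟨h3, h4⟩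
  rcases abs_cases t with ⟨h1, h2⟩ | ⟨h1, h2⟩
  · rw [max_eq_left (by linarith), max_eq_left h2, if_pos h2]; ring
  · rw [max_eq_right (by linarith), max_eq_right h2.le, if_neg (by linarith)]; ring

lemma kk_integral (s x : ℝ) : ∫ t in Set.Iic s, kk t x = max (s - x) 0 - max s 0 := by
  have e : ∀ y : ℝ, (fun t : ℝ => if y ≤ t then (1 : ℝ) else 0) =
      (Set.Ici y).indicator (fun _ => (1 : ℝ)) := by
    intro y; ext t; simp [Set.indicator_apply]
  have i : ∀ y : ℝ, IntegrableOn (fun t : ℝ => if y ≤ t then (1 : ℝ) else 0) (Set.Iic s) := by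
    intro y
    rw [e, IntegrableOn, integrable_indicator_iff measurableSet_Ici, IntegrableOn,
      Measure.restrict_restrict measurableSet_Ici, Set.Ici_inter_Iic]
    exact integrableOn_const (by simp)
  have v : ∀ y : ℝ, ∫ t in Set.Iic s, (if y ≤ t then (1 : ℝ) else 0) = max (s - y) 0 := by
    intro y
    rw [e, integral_indicator measurableSet_Ici, Measure.restrict_restrict measurableSet_Ici,
      Set.Ici_inter_Iic]
    simp [Measure.real, ENNReal.toReal_ofReal']
  unfold kk
  rw [integral_sub (i x) (i 0), v, v, sub_zero]

lemma ph_integral (x : ℝ) : ∫ s, ph s x = x ^ 2 / 2 := by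
  rcases le_total 0 x with hx | hx
  · have e : (fun s => ph s x) = (Set.Ico 0 x).indicator (fun s => x - s) := by
      ext s
      unfold ph
      rw [Set.indicator_apply]
      rcases max_cases (s - x) 0 with ⟨h3, h4⟩ | ⟨h3, h4⟩ <;>
      rcases max_cases s 0 with ⟨h5, h6⟩ | ⟨h5, h6⟩ <;> rw [h3, h5] <;> split_ifs with h7 h8 h8 <;>
      simp only [Set.mem_Ico, not_and, not_lt] at * <;> first | linarith | (exfalso; linarith [h8.1, h8.2]) | (exfalso; linarith [h8 (by linarith)])
    rw [e, integral_indicator measurableSet_Ico, integral_Ico_eq_integral_Ioc,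
      ← intervalIntegral.integral_of_le hx, intervalIntegral.integral_sub (by simp) (by simp)]
    simp; ring
  · have e : (fun s => ph s x) = (Set.Ico x 0).indicator (fun s => s - x) := by
      ext s
      unfold ph
      rw [Set.indicator_apply]
      rcases max_cases (s - x) 0 with ⟨h3, h4⟩ | ⟨h3, h4⟩ <;>
      rcases max_cases s 0 with ⟨h5, h6⟩ | ⟨h5, h6⟩ <;> rw [h3, h5] <;> split_ifs with h7 h8 h8 <;>
      simp only [Set.mem_Ico, not_and, not_lt] at * <;> first | linarith | (exfalso; linarith [h8.1, h8.2]) | (exfalso; linarith [h8 (by linarith)])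
    rw [e, integral_indicator measurableSet_Ico, integral_Ico_eq_integral_Ioc,
      ← intervalIntegral.integral_of_le hx, intervalIntegral.integral_sub (by simp) (by simp)]
    simp; ring

lemma int_abs (μ : Measure ℝ) [IsProbabilityMeasure μ]
    (h2 : Integrable (fun x : ℝ => x ^ 2) μ) : Integrable (fun x : ℝ => x) μ := by
  refine ((integrable_const (1 : ℝ)).add h2).mono' (by fun_prop) (ae_of_all _ fun x => ?_)
  simp only [Real.norm_eq_abs, Pi.add_apply]
  nlinarith [sq_nonneg (|x| - 1), sq_abs x]

lemma cdf_kk (μ : Measure ℝ) [IsProbabilityMeasure μ] (t : ℝ) :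
    cdf μ t - (if 0 ≤ t then 1 else 0) = ∫ x, kk t x ∂μ := by
  have e : (fun x : ℝ => if x ≤ t then (1 : ℝ) else 0) =
      (Set.Iic t).indicator (fun _ => (1 : ℝ)) := by
    ext x; simp [Set.indicator_apply]
  unfold kk
  rw [integral_sub _ (integrable_const _), e, integral_indicator measurableSet_Iic, cdf_eq_real]
  · simp
  · rw [e, integrable_indicator_iff measurableSet_Iic]
    exact integrableOn_const (by simp)

section single
variable (μ : Measure ℝ) [IsProbabilityMeasure μ]

lemma kk_int (h1 : Integrable (fun x : ℝ => x) μ) :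
    Integrable (Function.uncurry kk) ((volume : Measure ℝ).prod μ) :=
  gen_int μ kk (fun _ => 1) kk_meas measurable_const (by simp) kk_le kk_zero (by simpa using h1.abs)

lemma ph_int (m : ℕ) (h2 : Integrable (fun x : ℝ => |x| ^ (m + 2)) μ) :
    Integrable (Function.uncurry fun s x => |s| ^ m * ph s x) ((volume : Measure ℝ).prod μ) := by
  refine gen_int μ (fun s x => |s| ^ m * ph s x) (fun x => |x| ^ (m + 1)) ?_ (by fun_prop)
    (fun x => by positivity) (fun t x => ?_) (fun t x h => by simp [ph_zero t x h]) ?_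
  · have := ph_meas
    exact Measurable.mul (by fun_prop) this
  · by_cases h : |x| < |t|
    · rw [ph_zero t x h, mul_zero, abs_zero]; positivity
    · rw [abs_mul, abs_pow, abs_abs, pow_succ]
      have := ph_le t x
      have := not_lt.1 h
      gcongr
  · refine h2.congr (ae_of_all _ fun x => ?_)
    simp only; ring

/-- Integrated kernel. -/
noncomputable def Ph (s : ℝ) : ℝ := ∫ x, ph s x ∂μ

lemma Ph_meas : Measurable (Ph μ) := by
  have h : StronglyMeasurable (Function.uncurry ph) := ph_meas.stronglyMeasurable
  exact (h.integral_prod_right (ν := μ)).measurable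

lemma Ph_int (m : ℕ) (h2 : Integrable (fun x : ℝ => |x| ^ (m + 2)) μ) :
    Integrable (fun s => |s| ^ m * Ph μ s) := by
  refine (ph_int μ m h2).integral_prod_left.congr (ae_of_all _ fun s => ?_)
  simp only [Function.uncurry, Ph]
  rw [integral_const_mul]

lemma Ph_integral (h2 : Integrable (fun x : ℝ => x ^ 2) μ) :
    ∫ s, Ph μ s = (∫ x, x ^ 2 ∂μ) / 2 := by
  have h := ph_int μ 0 (by simpa using h2)
  simp only [pow_zero, one_mul] at h
  unfold Ph
  rw [integral_integral_swap h]
  simp_rw [ph_integral]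
  rw [integral_div]

lemma cdf_int (h1 : Integrable (fun x : ℝ => x) μ) :
    Integrable (fun t => cdf μ t - (if 0 ≤ t then 1 else 0)) := by
  simp_rw [cdf_kk μ]
  exact (kk_int μ h1).integral_prod_left

lemma cdf_integral (h1 : Integrable (fun x : ℝ => x) μ) (s : ℝ) :
    ∫ t in Set.Iic s, (cdf μ t - (if 0 ≤ t then 1 else 0)) =
      Ph μ s - (if 0 ≤ s then ∫ x, x ∂μ else 0) := by
  simp_rw [cdf_kk μ]
  have h := kk_int μ h1
  have h' : Integrable (Function.uncurry kk) (((volume : Measure ℝ).restrict (Set.Iic s)).prod μ) :=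
    h.mono_measure (Measure.prod_mono Measure.restrict_le_self le_rfl)
  rw [integral_integral_swap h']
  simp_rw [kk_integral]
  have hi : Integrable (fun x => max (s - x) 0 - max s 0) μ :=
    (((integrable_const s).sub h1).pos_part).sub (integrable_const _)
  unfold Ph ph
  split_ifs
  · rw [integral_add hi h1]; ring
  · simp

lemma cdf_conv (η : Measure ℝ) [IsProbabilityMeasure η] (t : ℝ) :
    cdf (μ.conv η) t = ∫ z, cdf μ (t - z) ∂η := by
  have h : (μ.conv η) (Set.Iic t) = ∫⁻ z, ENNReal.ofReal (cdf μ (t - z)) ∂η := by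
    rw [Measure.conv_comm, ← lintegral_indicator_one measurableSet_Iic,
      Measure.lintegral_conv (measurable_one.indicator measurableSet_Iic)]
    congr 1; ext z
    rw [cdf_eq_real, ofReal_measureReal, ← lintegral_indicator_one measurableSet_Iic]
    congr 1; ext x
    simp [Set.indicator_apply, le_sub_iff_add_le']
  rw [cdf_eq_real, measureReal_def, h, integral_eq_lintegral_of_nonneg_ae]
  · exact ae_of_all _ fun z => cdf_nonneg μ _
  · have : Measurable (cdf μ) := (monotone_cdf μ).measurable
    exact (this.comp (by fun_prop : Measurable fun z : ℝ => t - z)).aestronglyMeasurable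

end single

lemma shift_int (D : ℝ → ℝ) (hD : Integrable D) (η : Measure ℝ) [IsProbabilityMeasure η] :
    Integrable (fun q : ℝ × ℝ => D (q.1 - q.2)) ((volume : Measure ℝ).prod η) := by
  have h1 : Integrable (fun q : ℝ × ℝ => D q.1) ((volume : Measure ℝ).prod η) := hD.comp_fst η
  exact (measurePreserving_sub_prod volume η).integrable_comp_of_integrable h1

lemma final_eq (μ ν : Measure ℝ) [IsProbabilityMeasure μ] [IsProbabilityMeasure ν]
    (hμ : Integrable (fun x : ℝ => x) μ) (hν : Integrable (fun x : ℝ => x) ν)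
    (hmean : (∫ x, x ∂μ) = ∫ x, x ∂ν) (η : Measure ℝ) [IsProbabilityMeasure η] (x : ℝ) :
    ∫ t in Set.Iic x, (cdf (ν.conv η) t - cdf (μ.conv η) t) =
      ∫ z, (Ph ν (x - z) - Ph μ (x - z)) ∂η := by
  have hD : Integrable (fun t => cdf ν t - cdf μ t) := by
    refine ((cdf_int ν hν).sub (cdf_int μ hμ)).congr (ae_of_all _ fun t => ?_)
    simp
  have hG : ∀ s, ∫ t in Set.Iic s, (cdf ν t - cdf μ t) = Ph ν s - Ph μ s := by
    intro s
    have := integral_sub ((cdf_int ν hν).integrableOn (s := Set.Iic s))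
      ((cdf_int μ hμ).integrableOn (s := Set.Iic s))
    rw [cdf_integral ν hν, cdf_integral μ hμ, hmean] at this
    simpa using this
  have hci : ∀ (κ : Measure ℝ) (t : ℝ), Integrable (fun z => cdf κ (t - z)) η := by
    intro κ t
    have : Measurable (cdf κ) := (monotone_cdf κ).measurable
    refine (integrable_const (1 : ℝ)).mono'
      (this.comp (by fun_prop : Measurable fun z : ℝ => t - z)).aestronglyMeasurable
      (ae_of_all _ fun z => ?_)
    rw [Real.norm_of_nonneg (cdf_nonneg κ _)]
    exact cdf_le_one κ _
  have e1 : ∀ t, cdf (ν.conv η) t - cdf (μ.conv η) t = ∫ z, (cdf ν (t - z) - cdf μ (t - z)) ∂η := by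
    intro t
    rw [cdf_conv, cdf_conv, integral_sub (hci ν t) (hci μ t)]
  simp_rw [e1]
  have h := shift_int _ hD η
  have h' : Integrable (Function.uncurry fun t z => cdf ν (t - z) - cdf μ (t - z))
      (((volume : Measure ℝ).restrict (Set.Iic x)).prod η) :=
    h.mono_measure (Measure.prod_mono Measure.restrict_le_self le_rfl)
  rw [integral_integral_swap h']
  congr 1; ext z
  rw [← hG, ← integral_indicator measurableSet_Iic, ← integral_indicator measurableSet_Iic,
    
    ← integral_sub_right_eq_self ((Set.Iic (x - z)).indicator _) z]
  congr 1; ext t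
  simp [Set.indicator_apply]

theorem stmt_5 (μ ν : Measure ℝ) [IsProbabilityMeasure μ] [IsProbabilityMeasure ν]
    (hμ2 : Integrable (fun x : ℝ => x ^ 2) μ) (hν2 : Integrable (fun x : ℝ => x ^ 2) ν)
    (hmean : (∫ x, x ∂μ) = ∫ x, x ∂ν)
    (hvar : (∫ x, x ^ 2 ∂μ) - (∫ x, x ∂μ) ^ 2 < (∫ x, x ^ 2 ∂ν) - (∫ x, x ∂ν) ^ 2) :
    (∃ η : Measure ℝ, IsProbabilityMeasure η ∧ StrictSSD (μ.conv η) (ν.conv η)) ∧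
    (HasAllMoments μ → HasAllMoments ν →
      ∃ η : Measure ℝ, IsProbabilityMeasure η ∧ HasAllMoments η ∧
        StrictSSD (μ.conv η) (ν.conv η)) := by
  have hμ := int_abs μ hμ2
  have hν := int_abs ν hν2
  have hGm : Measurable (fun s => Ph ν s - Ph μ s) := (Ph_meas ν).sub (Ph_meas μ)
  have iν : Integrable (Ph ν) := by simpa using Ph_int ν 0 (by simpa using hν2)
  have iμ : Integrable (Ph μ) := by simpa using Ph_int μ 0 (by simpa using hμ2)
  have hGi : Integrable (fun s => Ph ν s - Ph μ s) := iν.sub iμ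
  have hGpos : 0 < ∫ s, (Ph ν s - Ph μ s) := by
    rw [integral_sub iν iμ, Ph_integral ν hν2, Ph_integral μ hμ2]
    rw [hmean] at hvar
    linarith
  obtain ⟨η, hη, hpos, hmom⟩ := key _ hGm hGi hGpos
  have hstrict : StrictSSD (μ.conv η) (ν.conv η) := by
    refine ⟨fun x => ?_, fun heq => ?_⟩
    · rw [final_eq μ ν hμ hν hmean η x]
      exact hpos x
    · have h0 : ∀ x, ∫ z, (Ph ν (x - z) - Ph μ (x - z)) ∂η = 0 := by
        intro x
        rw [← final_eq μ ν hμ hν hmean η x, heq]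
        simp
      have h1 : ∫ x, ∫ z, (Ph ν (x - z) - Ph μ (x - z)) ∂η = 0 := by simp [h0]
      rw [integral_integral_swap (f := fun x z => Ph ν (x - z) - Ph μ (x - z))
        (shift_int _ hGi η)] at h1
      have h2 : ∀ z, ∫ x, (Ph ν (x - z) - Ph μ (x - z)) = ∫ s, (Ph ν s - Ph μ s) := fun z =>
        integral_sub_right_eq_self (fun s => Ph ν s - Ph μ s) z
      simp_rw [h2] at h1
      simp at h1
      linarith
  refine ⟨⟨η, hη, hstrict⟩, fun mμ mν => ⟨η, hη, hmom fun m => ?_, hstrict⟩⟩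
  refine ((Ph_int ν m (mν _)).sub (Ph_int μ m (mμ _))).congr (ae_of_all _ fun s => ?_)
  simp only [Pi.sub_apply]; ring
end

section
/- Fix n ∈ {0, 1, 2, …} or n = ∞. Let μ⁺ and μ⁻ be finite Borel measures on ℝ with μ⁺(ℝ) − μ⁻(ℝ) = 1 and with ∫|x|^n d(μ⁺ + μ⁻)(x) < ∞ (all such moments finite when n = ∞). Then there exists a Borel probability measure η on ℝ with ∫|x|^n dη(x) < ∞ (all moments finite when n = ∞) such that μ⁻ ∗ η ≤ μ⁺ ∗ η setwise, i.e. (μ⁻ ∗ η)(A) ≤ (μ⁺ ∗ η)(A) for every Borel set A ⊆ ℝ. (Equivalently: the signed measure μ = μ⁺ − μ⁻, which has total mass 1 and finite n-th moment, becomes a probability measure after convolution with η.) -/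
open MeasureTheory ProbabilityTheory

/-- The submultiplicative weight `(1 + l |x|)^m`. -/
noncomputable def wt (l : ℝ) (m : ℕ) (x : ℝ) : ENNReal := ENNReal.ofReal ((1 + l * |x|) ^ m)

lemma measurable_wt (l : ℝ) (m : ℕ) : Measurable (wt l m) := by
  unfold wt; fun_prop

lemma wt_add_le {l : ℝ} (hl : 0 ≤ l) (m : ℕ) (x y : ℝ) :
    wt l m (x + y) ≤ wt l m x * wt l m y := by
  unfold wt
  rw [← ENNReal.ofReal_mul (by positivity), ← mul_pow]
  apply ENNReal.ofReal_le_ofReal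
  apply pow_le_pow_left₀ (by positivity)
  have h1 := abs_add_le x y
  have h2 : 0 ≤ l * |x| * (l * |y|) := by positivity
  nlinarith [mul_le_mul_of_nonneg_left h1 hl]

lemma conv_wt_le {l : ℝ} (hl : 0 ≤ l) (m : ℕ) (μ ν : Measure ℝ) [SFinite μ] [SFinite ν] :
    ∫⁻ x, wt l m x ∂(μ.conv ν) ≤ (∫⁻ x, wt l m x ∂μ) * ∫⁻ x, wt l m x ∂ν := by
  have hm := measurable_wt l m
  rw [Measure.lintegral_conv hm]
  calc ∫⁻ x, ∫⁻ y, wt l m (x + y) ∂ν ∂μ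
      ≤ ∫⁻ x, ∫⁻ y, wt l m x * wt l m y ∂ν ∂μ :=
        lintegral_mono fun x => lintegral_mono fun y => wt_add_le hl m x y
    _ = ∫⁻ x, wt l m x * ∫⁻ y, wt l m y ∂ν ∂μ := by
        congr 1; ext x; rw [lintegral_const_mul _ hm]
    _ = _ := lintegral_mul_const _ hm

lemma wt_le_of_le_one {l : ℝ} (hl : 0 ≤ l) (hl1 : l ≤ 1) (m : ℕ) (x : ℝ) :
    wt l m x ≤ 1 + ENNReal.ofReal l * wt 1 m x := by
  unfold wt
  rw [← ENNReal.ofReal_mul hl, ← ENNReal.ofReal_one, ← ENNReal.ofReal_add (by norm_num)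
    (by positivity)]
  apply ENNReal.ofReal_le_ofReal
  have h := (convexOn_pow (𝕜 := ℝ) m).2 (x := 1) (y := 1 + |x|) (by simp)
    (by simp; positivity) (sub_nonneg.2 hl1) hl (by ring)
  simp only [smul_eq_mul, one_pow] at h
  have e : (1 - l) * 1 + l * (1 + |x|) = 1 + l * |x| := by ring
  rw [e] at h
  rw [one_mul]
  linarith

lemma wt_one_le {l : ℝ} (hl : 0 < l) (hl1 : l ≤ 1) (m : ℕ) (x : ℝ) :
    wt 1 m x ≤ ENNReal.ofReal ((l⁻¹) ^ m) * wt l m x := by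
  unfold wt
  rw [← ENNReal.ofReal_mul (by positivity), ← mul_pow]
  apply ENNReal.ofReal_le_ofReal
  apply pow_le_pow_left₀ (by positivity)
  have : 1 ≤ l⁻¹ := (one_le_inv₀ hl).2 hl1
  rw [mul_add, ← mul_assoc, inv_mul_cancel₀ hl.ne']
  linarith

/-- Convolution powers. -/
noncomputable def cpow (s : Measure ℝ) : ℕ → Measure ℝ
  | 0 => Measure.dirac 0
  | k + 1 => s.conv (cpow s k)

instance (s : Measure ℝ) [IsFiniteMeasure s] (k : ℕ) : IsFiniteMeasure (cpow s k) := by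
  induction k with
  | zero => unfold cpow; infer_instance
  | succ k ih => unfold cpow; infer_instance

lemma lintegral_wt_zero (l : ℝ) (s : Measure ℝ) : ∫⁻ x, wt l 0 x ∂s = s Set.univ := by
  simp [wt]

lemma exists_resolvent (s : Measure ℝ) [IsFiniteMeasure s] (hs : s Set.univ < 1) :
    ∃ κ : Measure ℝ, IsFiniteMeasure κ ∧ κ = Measure.dirac 0 + s.conv κ ∧
      ∀ m : ℕ, ∫⁻ x, wt 1 m x ∂s < ⊤ → ∫⁻ x, wt 1 m x ∂κ < ⊤ := by
  have hmom : ∀ m : ℕ, ∫⁻ x, wt 1 m x ∂s < ⊤ → 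
      ∫⁻ x, wt 1 m x ∂(Measure.sum (cpow s)) < ⊤ := by
    intro m hm
    obtain ⟨l, hl, hl1, hlt⟩ : ∃ l : ℝ, 0 < l ∧ l ≤ 1 ∧ ∫⁻ x, wt l m x ∂s < 1 := by
      have ht : Filter.Tendsto (fun l : ℝ => s Set.univ + ENNReal.ofReal l * ∫⁻ x, wt 1 m x ∂s)
          (nhdsWithin 0 (Set.Ioi 0)) (nhds (s Set.univ + ENNReal.ofReal 0 * ∫⁻ x, wt 1 m x ∂s)) := by
        apply Filter.Tendsto.mono_left _ nhdsWithin_le_nhds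
        apply Filter.Tendsto.add tendsto_const_nhds
        apply ENNReal.Tendsto.mul_const
        · exact ENNReal.tendsto_ofReal Filter.tendsto_id
        · right; exact hm.ne
      simp only [ENNReal.ofReal_zero, zero_mul, add_zero] at ht
      have h1 := ht.eventually_lt_const hs
      have h2 : ∀ᶠ l : ℝ in nhdsWithin 0 (Set.Ioi 0), l ∈ Set.Ioo (0:ℝ) 1 :=
        Ioo_mem_nhdsGT (by norm_num)
      obtain ⟨l, hl1, hl2⟩ := (h1.and h2).exists
      refine ⟨l, hl2.1, hl2.2.le, lt_of_le_of_lt ?_ hl1⟩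
      calc ∫⁻ x, wt l m x ∂s ≤ ∫⁻ x, 1 + ENNReal.ofReal l * wt 1 m x ∂s :=
            lintegral_mono fun x => wt_le_of_le_one hl2.1.le hl2.2.le m x
        _ = _ := by
          rw [lintegral_add_left measurable_const, lintegral_const_mul _ (measurable_wt _ _)]
          simp
    have hk : ∀ k, ∫⁻ x, wt l m x ∂(cpow s k) ≤ (∫⁻ x, wt l m x ∂s) ^ k := by
      intro k
      induction k with
      | zero => 
        simp only [cpow, pow_zero]
        rw [lintegral_dirac' _ (measurable_wt _ _)]
        simp [wt]
      | succ k ih =>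
        simp only [cpow]
        refine (conv_wt_le hl.le m _ _).trans ?_
        rw [pow_succ']
        gcongr
    have hfin : ∫⁻ x, wt l m x ∂(Measure.sum (cpow s)) < ⊤ := by
      rw [lintegral_sum_measure]
      refine lt_of_le_of_lt (ENNReal.tsum_le_tsum hk) ?_
      rw [ENNReal.tsum_geometric]
      simp [hlt]
    calc ∫⁻ x, wt 1 m x ∂(Measure.sum (cpow s)) 
        ≤ ∫⁻ x, ENNReal.ofReal ((l⁻¹) ^ m) * wt l m x ∂(Measure.sum (cpow s)) :=
          lintegral_mono fun x => wt_one_le hl hl1 m x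
      _ = ENNReal.ofReal ((l⁻¹) ^ m) * ∫⁻ x, wt l m x ∂(Measure.sum (cpow s)) := 
          lintegral_const_mul _ (measurable_wt _ _)
      _ < ⊤ := ENNReal.mul_lt_top ENNReal.ofReal_lt_top hfin
  have hfin : IsFiniteMeasure (Measure.sum (cpow s)) := by
    have := hmom 0 (by rw [lintegral_wt_zero]; exact measure_lt_top _ _)
    rw [lintegral_wt_zero] at this
    exact ⟨this⟩
  refine ⟨Measure.sum (cpow s), hfin, ?_, hmom⟩
  refine Measure.ext_of_lintegral _ fun f hf => ?_
  rw [lintegral_add_measure, Measure.lintegral_conv hf, lintegral_sum_measure,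
    tsum_eq_zero_add' ENNReal.summable]
  simp only [cpow]
  congr 1
  simp_rw [lintegral_sum_measure]
  rw [lintegral_tsum]
  · congr 1; ext k
    rw [Measure.lintegral_conv hf]
  · intro k
    apply Measurable.aemeasurable
    exact Measurable.lintegral_prod_right' (f := fun p : ℝ × ℝ => f (p.1 + p.2)) (by fun_prop)

/-- Unnormalised Laplace measure. -/
noncomputable def lap (e : ℝ) : Measure ℝ :=
  volume.withDensity fun x => ENNReal.ofReal (Real.exp (-(e * |x|)))

lemma lap_wt {e : ℝ} (he : 0 < e) (m : ℕ) : ∫⁻ x, wt 1 m x ∂(lap e) < ⊤ := by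
  unfold lap
  rw [lintegral_withDensity_eq_lintegral_mul _ (by fun_prop) (measurable_wt _ _)]
  set C : ℝ := Real.exp e * (m + 2).factorial / e ^ (m + 2) with hC
  have hint : Integrable (fun x : ℝ => C * (1 + x ^ 2)⁻¹) := integrable_inv_one_add_sq.const_mul C
  refine lt_of_le_of_lt (lintegral_mono fun x => ?_) hint.lintegral_lt_top
  simp only [Pi.mul_apply, wt, one_mul]
  rw [← ENNReal.ofReal_mul (by positivity)]
  apply ENNReal.ofReal_le_ofReal
  have h := Real.pow_div_factorial_le_exp (e * (1 + |x|)) (by positivity) (m + 2)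
  have hf : (0:ℝ) < (m + 2).factorial := by positivity
  rw [div_le_iff₀ hf, mul_pow, mul_add, Real.exp_add, mul_one] at h
  have hep : 0 < e ^ (m + 2) := by positivity
  rw [← div_eq_mul_inv, le_div_iff₀ (by positivity), hC, le_div_iff₀ hep, Real.exp_neg]
  have h2 : 1 + x ^ 2 ≤ (1 + |x|) ^ 2 := by
    rw [← sq_abs x]; nlinarith [abs_nonneg x]
  have hE := Real.exp_pos (e * |x|)
  rw [mul_assoc, mul_assoc, inv_mul_le_iff₀ hE]
  calc (1 + |x|) ^ m * ((1 + x ^ 2) * e ^ (m + 2)) 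
      ≤ (1 + |x|) ^ m * ((1 + |x|) ^ 2 * e ^ (m + 2)) := by gcongr
    _ = e ^ (m + 2) * (1 + |x|) ^ (m + 2) := by ring
    _ ≤ _ := h
    _ = _ := by ring

lemma lap_finite {e : ℝ} (he : 0 < e) : IsFiniteMeasure (lap e) := by
  have := lap_wt he 0
  rw [lintegral_wt_zero] at this
  exact ⟨this⟩

lemma lap_pos (e : ℝ) : lap e Set.univ ≠ 0 := by
  intro h
  rw [Measure.measure_univ_eq_zero, lap, withDensity_eq_zero_iff (by fun_prop)] at h
  have h2 : ∀ᵐ x : ℝ, False := by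
    filter_upwards [h] with x hx
    simp at hx
    exact absurd hx (not_le.2 (Real.exp_pos _))
  simp at h2
  exact NeZero.ne (volume : Measure ℝ) h2

lemma lap_lintegral (e x : ℝ) {f : ℝ → ENNReal} (hf : Measurable f) :
    ∫⁻ y, f (x + y) ∂(lap e) = ∫⁻ y, ENNReal.ofReal (Real.exp (-(e * |y - x|))) * f y := by
  unfold lap
  rw [lintegral_withDensity_eq_lintegral_mul _ (by fun_prop) (by fun_prop)]
  rw [← lintegral_add_left_eq_self (μ := (volume : Measure ℝ)) (fun y =>
    ENNReal.ofReal (Real.exp (-(e * |y - x|))) * f y) x]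
  simp

lemma lap_upper {e : ℝ} (he : 0 < e) {x R : ℝ} (hx : |x| ≤ R) {f : ℝ → ENNReal}
    (hf : Measurable f) :
    ∫⁻ y, f (x + y) ∂(lap e) ≤ ENNReal.ofReal (Real.exp (e * R)) * ∫⁻ y, f y ∂(lap e) := by
  have h0 := lap_lintegral e 0 hf
  simp only [zero_add, sub_zero] at h0
  rw [lap_lintegral e x hf, h0, ← lintegral_const_mul _ (by fun_prop)]
  refine lintegral_mono fun y => ?_
  rw [← mul_assoc, ← ENNReal.ofReal_mul (by positivity), ← Real.exp_add]
  gcongr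
  have := abs_sub_abs_le_abs_sub y x
  nlinarith

lemma lap_lower {e : ℝ} (he : 0 < e) {x R : ℝ} (hx : |x| ≤ R) {f : ℝ → ENNReal}
    (hf : Measurable f) :
    ENNReal.ofReal (Real.exp (-(e * R))) * ∫⁻ y, f y ∂(lap e) ≤ ∫⁻ y, f (x + y) ∂(lap e) := by
  have h0 := lap_lintegral e 0 hf
  simp only [zero_add, sub_zero] at h0
  rw [lap_lintegral e x hf, h0, ← lintegral_const_mul _ (by fun_prop)]
  refine lintegral_mono fun y => ?_
  rw [← mul_assoc, ← ENNReal.ofReal_mul (by positivity), ← Real.exp_add]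
  gcongr
  have := abs_sub y x
  nlinarith

lemma exists_tail (ν : Measure ℝ) [IsFiniteMeasure ν] :
    ∃ R : ℝ, 0 ≤ R ∧ ν {x : ℝ | |x| ≤ R}ᶜ < 1 / 4 := by
  have h : Filter.Tendsto (fun N : ℕ => ν {x : ℝ | |x| ≤ (N:ℝ)}ᶜ) Filter.atTop
      (nhds (ν (⋂ N : ℕ, {x : ℝ | |x| ≤ (N:ℝ)}ᶜ))) := by
    apply tendsto_measure_iInter_atTop
    · intro N
      exact (measurableSet_le (by fun_prop) (by fun_prop)).compl.nullMeasurableSet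
    · intro a b hab x hx hx2
      have hab' : (a : ℝ) ≤ b := by exact_mod_cast hab
      have hx3 : |x| ≤ (a : ℝ) := hx2
      have hx4 : |x| ≤ (b : ℝ) := hx3.trans hab'
      exact hx hx4
    · exact ⟨0, measure_ne_top _ _⟩
  have he : (⋂ N : ℕ, {x : ℝ | |x| ≤ (N:ℝ)}ᶜ) = ∅ := by
    ext x
    simp only [Set.mem_iInter, Set.mem_compl_iff, Set.mem_ofPred_eq, Set.mem_empty_iff_false,
      iff_false, not_forall, not_not]
    exact exists_nat_ge |x|
  rw [he, measure_empty] at h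
  obtain ⟨N, hN⟩ := (h.eventually_lt_const (by norm_num : (0:ENNReal) < 1 / 4)).exists
  exact ⟨N, by positivity, hN⟩

lemma exists_eps (a R : ℝ) : ∃ e : ℝ, 0 < e ∧
    Real.exp (e * R) * a + 1 / 2 ≤ Real.exp (-(e * R)) * (a + 3 / 4) := by
  have h : Filter.Tendsto (fun e : ℝ => Real.exp (-(e * R)) * (a + 3 / 4) -
      (Real.exp (e * R) * a + 1 / 2)) (nhdsWithin 0 (Set.Ioi 0)) (nhds (
      Real.exp (-(0 * R)) * (a + 3 / 4) - (Real.exp (0 * R) * a + 1 / 2))) := by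
    apply Filter.Tendsto.mono_left _ nhdsWithin_le_nhds
    exact Continuous.tendsto (by fun_prop) _
  have h1 := h.eventually_const_lt (u := 0) (by simp; linarith)
  obtain ⟨e, h1, h2⟩ := (h1.and self_mem_nhdsWithin).exists
  exact ⟨e, h2, by linarith⟩

lemma integrable_of_wt {ν : Measure ℝ} {m : ℕ} (h : ∫⁻ x, wt 1 m x ∂ν < ⊤) :
    Integrable (fun x : ℝ => |x| ^ m) ν := by
  refine ⟨by fun_prop, ?_⟩
  refine lt_of_le_of_lt (lintegral_mono fun x => ?_) h
  rw [← ofReal_norm, wt]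
  apply ENNReal.ofReal_le_ofReal
  simp only [norm_pow, Real.norm_eq_abs, abs_abs, one_mul]
  gcongr
  linarith

lemma wt_of_integrable {ν : Measure ℝ} [IsFiniteMeasure ν] {m : ℕ}
    (h : Integrable (fun x : ℝ => |x| ^ m) ν) : ∫⁻ x, wt 1 m x ∂ν < ⊤ := by
  have hi : Integrable (fun x : ℝ => 2 ^ (m - 1) * (1 ^ m + |x| ^ m)) ν :=
    ((integrable_const _).add h).const_mul _
  refine lt_of_le_of_lt (lintegral_mono fun x => ?_) hi.lintegral_lt_top
  unfold wt
  apply ENNReal.ofReal_le_ofReal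
  rw [one_mul]
  exact add_pow_le (by norm_num) (abs_nonneg x) m

lemma main_bound {e R : ℝ} (he : 0 < e) (A B : Measure ℝ) [IsFiniteMeasure A] [IsFiniteMeasure B]
    (hA : ∀ᵐ x ∂A, |x| ≤ R) (hB : ∀ᵐ x ∂B, |x| ≤ R)
    (h : ENNReal.ofReal (Real.exp (e * R)) * A Set.univ + 1 / 2 ≤
      ENNReal.ofReal (Real.exp (-(e * R))) * B Set.univ) :
    A.conv (lap e) + (1 / 2 : ENNReal) • lap e ≤ B.conv (lap e) := by
  have := lap_finite he
  refine Measure.le_iff.2 fun S hS => ?_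
  set f : ℝ → ENNReal := S.indicator 1 with hf
  have hfm : Measurable f := measurable_one.indicator hS
  rw [Measure.add_apply, Measure.smul_apply, smul_eq_mul]
  simp only [← lintegral_indicator_one hS]
  rw [← hf, Measure.lintegral_conv hfm, Measure.lintegral_conv hfm]
  set I := ∫⁻ y, f y ∂(lap e)
  calc _ ≤ (∫⁻ x, ENNReal.ofReal (Real.exp (e * R)) * I ∂A) + 1 / 2 * I := by
        gcongr ?_ + _
        exact lintegral_mono_ae (hA.mono fun x hx => lap_upper he hx hfm)
    _ = (ENNReal.ofReal (Real.exp (e * R)) * A Set.univ + 1 / 2) * I := by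
        rw [lintegral_const]; ring
    _ ≤ (ENNReal.ofReal (Real.exp (-(e * R))) * B Set.univ) * I := by gcongr
    _ = ∫⁻ x, ENNReal.ofReal (Real.exp (-(e * R))) * I ∂B := by
        rw [lintegral_const]; ring
    _ ≤ _ := lintegral_mono_ae (hB.mono fun x hx => lap_lower he hx hfm)

lemma conv_mono_left {A B : Measure ℝ} (h : A ≤ B) (C : Measure ℝ) [SFinite C] :
    A.conv C ≤ B.conv C := by
  refine Measure.le_iff.2 fun S hS => ?_
  have hfm : Measurable (S.indicator (1 : ℝ → ENNReal)) := measurable_one.indicator hS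
  simp only [← lintegral_indicator_one hS]
  rw [Measure.lintegral_conv hfm, Measure.lintegral_conv hfm]
  exact lintegral_mono' h le_rfl

theorem stmt_7 (n : ℕ∞) (μp μm : Measure ℝ) [IsFiniteMeasure μp] [IsFiniteMeasure μm]
    (hmass : μp Set.univ = μm Set.univ + 1)
    (hmom : ∀ m : ℕ, (m : ℕ∞) ≤ n → Integrable (fun x : ℝ => |x| ^ m) (μp + μm)) :
    ∃ η : Measure ℝ, IsProbabilityMeasure η ∧
      (∀ m : ℕ, (m : ℕ∞) ≤ n → Integrable (fun x : ℝ => |x| ^ m) η) ∧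
      μm.conv η ≤ μp.conv η := by
  obtain ⟨R, hR, htail⟩ := exists_tail (μp + μm)
  set K : Set ℝ := {x : ℝ | |x| ≤ R} with hK
  have hKm : MeasurableSet K := measurableSet_le (by fun_prop) (by fun_prop)
  rw [Measure.add_apply] at htail
  have htp : μp Kᶜ < 1 / 4 := lt_of_le_of_lt le_self_add htail
  have htm : μm Kᶜ < 1 / 4 := lt_of_le_of_lt le_add_self htail
  obtain ⟨e, he, hineq⟩ := exists_eps (μm Set.univ).toReal R
  have := lap_finite he
  set t := μm.restrict Kᶜ with ht
  have hsplitm : μm.restrict K + t = μm := Measure.restrict_add_restrict_compl hKm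
  have hbound : (μm.restrict K).conv (lap e) + (1 / 2 : ENNReal) • lap e ≤
      (μp.restrict K).conv (lap e) := by
    refine main_bound (R := R) he _ _ (ae_restrict_mem hKm) (ae_restrict_mem hKm) ?_
    rw [Measure.restrict_apply_univ, Measure.restrict_apply_univ]
    have h1 : (μm Set.univ).toReal + 3 / 4 ≤ (μp K).toReal := by
      have h2 : μp K + μp Kᶜ = μm Set.univ + 1 := by rw [measure_add_measure_compl hKm, hmass]
      have h3 := congrArg ENNReal.toReal h2
      rw [ENNReal.toReal_add (measure_ne_top _ _) (measure_ne_top _ _),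
        ENNReal.toReal_add (measure_ne_top _ _) (by simp)] at h3
      have h4 := ENNReal.toReal_mono (by simp) htp.le
      simp at h4 h3
      linarith
    have h2 : (μm K).toReal ≤ (μm Set.univ).toReal :=
      ENNReal.toReal_mono (measure_ne_top _ _) (measure_mono (Set.subset_univ _))
    rw [← ENNReal.ofReal_toReal (measure_ne_top μm K), ← ENNReal.ofReal_toReal (measure_ne_top μp K),
      ← ENNReal.ofReal_mul (by positivity), ← ENNReal.ofReal_mul (by positivity)]
    have h12 : (1 / 2 : ENNReal) = ENNReal.ofReal (1 / 2) := by
      rw [ENNReal.ofReal_div_of_pos (by norm_num)]; simp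
    rw [h12, ← ENNReal.ofReal_add (by positivity) (by norm_num)]
    apply ENNReal.ofReal_le_ofReal
    calc _ ≤ Real.exp (e * R) * (μm Set.univ).toReal + 1 / 2 := by gcongr
      _ ≤ _ := hineq
      _ ≤ _ := by gcongr
  set s : Measure ℝ := (2 : ENNReal) • t with hs
  have : IsFiniteMeasure s := Measure.smul_finite t (by simp)
  have hs1 : s Set.univ < 1 := by
    rw [hs, Measure.smul_apply, ht, Measure.restrict_apply_univ, smul_eq_mul]
    calc 2 * μm Kᶜ ≤ 2 * (1 / 4) := by gcongr
      _ < 1 := by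
        rw [← ENNReal.toReal_lt_toReal (by finiteness) (by simp)]
        simp; norm_num
  obtain ⟨κ, hκf, hκ, hκm⟩ := exists_resolvent s hs1
  set ν := (lap e).conv κ with hν
  have hcore : μm.conv ν ≤ μp.conv ν := by
    have h1 : μm.conv (lap e) + (1 / 2 : ENNReal) • lap e ≤ μp.conv (lap e) + t.conv (lap e) := by
      conv_lhs => rw [← hsplitm]
      rw [Measure.add_conv, add_right_comm]
      gcongr
      exact hbound.trans (conv_mono_left Measure.restrict_le_self _)
    have h2 := conv_mono_left h1 κ
    have : IsFiniteMeasure ((1 / 2 : ENNReal) • lap e) := Measure.smul_finite _ (by simp)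
    rw [Measure.add_conv, Measure.add_conv, Measure.conv_assoc, Measure.conv_assoc,
      Measure.conv_assoc, Measure.conv_smul_left, ← hν] at h2
    have h3 : t.conv ν ≤ (1 / 2 : ENNReal) • ν := by
      have h4 : ν = lap e + (2 : ENNReal) • t.conv ν := by
        conv_lhs => rw [hν, hκ]
        rw [Measure.conv_add, Measure.conv_dirac_zero, ← Measure.conv_assoc,
          Measure.conv_comm (lap e) s, Measure.conv_assoc, ← hν, hs, Measure.conv_smul_left]
      have h5 : (2 : ENNReal) • t.conv ν ≤ ν := by
        conv_rhs => rw [h4]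
        exact Measure.le_add_left le_rfl
      calc t.conv ν = (1 / 2 : ENNReal) • ((2 : ENNReal) • t.conv ν) := by
            rw [smul_smul, one_div, ENNReal.inv_mul_cancel (by simp) (by simp), one_smul]
        _ ≤ _ := by
          refine Measure.le_iff.2 fun S hS => ?_
          have := h5 S
          simp only [Measure.smul_apply, smul_eq_mul] at this ⊢
          gcongr
    refine Measure.le_iff.2 fun S hS => ?_
    have h6 := h2 S
    have h7 := h3 S
    rw [Measure.add_apply, Measure.add_apply] at h6
    have h8 := (add_le_add_right h7 (μm.conv ν S)).trans h6
    exact (ENNReal.add_le_add_iff_right (measure_ne_top _ _)).1 h8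
  have hνmom : ∀ m : ℕ, (m : ℕ∞) ≤ n → ∫⁻ x, wt 1 m x ∂ν < ⊤ := by
    intro m hm
    refine lt_of_le_of_lt (conv_wt_le zero_le_one m _ _) ?_
    refine ENNReal.mul_lt_top (lap_wt he m) (hκm m ?_)
    rw [hs, lintegral_smul_measure, smul_eq_mul]
    refine ENNReal.mul_lt_top (by simp) (wt_of_integrable ?_)
    exact ((hmom m hm).mono_measure (Measure.le_add_left le_rfl)).mono_measure
      Measure.restrict_le_self
  have hν0 : ν Set.univ ≠ 0 := by
    intro h0
    have h1 : lap e ≤ ν := by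
      rw [hν, hκ, Measure.conv_add, Measure.conv_dirac_zero]
      exact Measure.le_add_right le_rfl
    exact lap_pos e (le_antisymm ((h1 _).trans h0.le) (zero_le))
  have : NeZero ν := ⟨fun h => hν0 (by simp [h])⟩
  refine ⟨(ν Set.univ)⁻¹ • ν, inferInstance, ?_, ?_⟩
  · intro m hm
    exact (integrable_of_wt (hνmom m hm)).smul_measure (ENNReal.inv_ne_top.2 hν0)
  · rw [Measure.conv_smul_right, Measure.conv_smul_right]
    refine Measure.le_iff.2 fun S hS => ?_
    have := hcore S
    simp only [Measure.smul_apply, smul_eq_mul]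
    gcongr
end

section
/- Let T be a finite nonempty set and let (μ_{t,s})_{t,s ∈ T} be a family of Borel probability measures on ℝ, each with finite absolute moments of all orders, such that for every t ∈ T and every s ≠ t one has ∫x dμ_{t,t}(x) > ∫x dμ_{t,s}(x). Then there exists a Borel probability measure ζ on ℝ with finite absolute moments of all orders and ∫x dζ(x) = 0 such that μ_{t,t} ∗ ζ >₁ μ_{t,s} ∗ ζ for every t ∈ T and every s ≠ t. -/
open MeasureTheory ProbabilityTheory

/-- `μ` first-order stochastically dominates `ν`: the CDF of `μ` lies below that of `ν`. -/
def FSD (μ ν : Measure ℝ) : Prop := ∀ t : ℝ, cdf μ t ≤ cdf ν t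

/-- Strict first-order stochastic dominance: `FSD` together with distinctness. -/
def StrictFSD (μ ν : Measure ℝ) : Prop := FSD μ ν ∧ μ ≠ ν

theorem aux_coeff (M : ℕ → ℝ) (hM : ∀ n, 0 ≤ M n) (δ : ℝ) (hδ : 0 < δ) :
    ∃ a : ℕ → ℝ, a 0 = 1 ∧ (∀ n, 0 < a n) ∧ (∀ n, a n ≤ 1 / (n.factorial : ℝ)) ∧
      (∀ k m, a (k + m) * ((k + m).choose k : ℝ) ≤ a k * a m) ∧
      Summable (fun n => a (n + 1) * M (n + 1)) ∧ ∑' n, a (n + 1) * M (n + 1) ≤ δ := by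
  obtain ⟨ε, hε0, hε1, hεδ⟩ : ∃ ε : ℝ, 0 < ε ∧ ε ≤ 1 ∧ ε * Real.exp 1 ≤ δ := by
    refine ⟨min 1 (δ / Real.exp 1), lt_min one_pos (by positivity), min_le_left _ _, ?_⟩
    calc _ ≤ (δ / Real.exp 1) * Real.exp 1 := by gcongr; exact min_le_right _ _
      _ = δ := by field_simp
  let P : ℕ → ℝ := fun n => ∏ j ∈ Finset.range n, (1 + M j)
  have hP1 : ∀ n, 1 ≤ P n := fun n => by
    induction n with
    | zero => simp [P]
    | succ n ih =>
      change 1 ≤ ∏ j ∈ Finset.range (n + 1), (1 + M j)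
      rw [Finset.prod_range_succ]
      change 1 ≤ P n * (1 + M n)
      nlinarith [hM n]
  have hPs : ∀ n, P (n + 1) = P n * (1 + M n) := fun n => Finset.prod_range_succ _ _
  have hPm : Monotone P := monotone_nat_of_le_succ (fun n => by
    rw [hPs]; nlinarith [hP1 n, hM n])
  let r : ℕ → ℝ := fun i => ε / P (i + 2)
  have hr0 : ∀ i, 0 < r i := fun i => div_pos hε0 (by linarith [hP1 (i + 2)])
  have hr1 : ∀ i, r i ≤ 1 := fun i => by
    refine (div_le_one (by linarith [hP1 (i + 2)])).2 (by linarith [hP1 (i + 2)])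
  have hra : Antitone r := fun i j hij => by
    refine div_le_div_of_nonneg_left hε0.le (by linarith [hP1 (i + 2)]) (hPm (by omega))
  let b : ℕ → ℝ := fun n => ∏ i ∈ Finset.range n, r i
  have hb0 : ∀ n, 0 < b n := fun n => Finset.prod_pos (fun i _ => hr0 i)
  have hb1 : ∀ n, b n ≤ 1 := fun n => Finset.prod_le_one (fun i _ => (hr0 i).le) (fun i _ => hr1 i)
  have hbs : ∀ n, b (n + 1) = b n * r n := fun n => Finset.prod_range_succ _ _
  have hbsub : ∀ k m, b (k + m) ≤ b k * b m := fun k m => by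
    change ∏ i ∈ Finset.range (k + m), r i ≤ _
    rw [Finset.prod_range_add]
    refine mul_le_mul_of_nonneg_left ?_ (hb0 k).le
    exact Finset.prod_le_prod (fun i _ => (hr0 _).le) (fun i _ => hra (by omega))
  have hbM : ∀ n, b (n + 1) * M (n + 1) ≤ ε := fun n => by
    have h1 : b (n + 1) ≤ r n := by
      rw [hbs]; nlinarith [hb1 n, hr0 n]
    have h2 : r n * M (n + 1) ≤ ε := by
      change ε / P (n + 2) * M (n + 1) ≤ ε
      have hp : 0 < P (n + 2) := by linarith [hP1 (n + 2)]
      rw [div_mul_eq_mul_div, div_le_iff₀ hp, hPs]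
      have := hP1 (n + 1)
      have := hM (n + 1)
      gcongr
      nlinarith
    exact (mul_le_mul_of_nonneg_right h1 (hM _)).trans h2
  have hterm : ∀ n, b (n + 1) / ((n + 1).factorial : ℝ) * M (n + 1) ≤ ε * (1 ^ n / (n.factorial : ℝ)) :=
    fun n => by
      have : (n.factorial : ℝ) ≤ ((n + 1).factorial : ℝ) := by
        exact_mod_cast Nat.factorial_le (Nat.le_succ n)
      have h0 : (0 : ℝ) < n.factorial := by positivity
      rw [one_pow, div_mul_eq_mul_div, mul_one_div]
      exact div_le_div₀ hε0.le (hbM n) h0 this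
  have hexp : HasSum (fun n : ℕ => ε * ((1 : ℝ) ^ n / (n.factorial : ℝ))) (ε * Real.exp 1) := by
    apply HasSum.mul_left
    rw [Real.exp_eq_exp_ℝ]
    exact NormedSpace.expSeries_div_hasSum_exp (1 : ℝ)
  have hsum : Summable (fun n => b (n + 1) / ((n + 1).factorial : ℝ) * M (n + 1)) :=
    Summable.of_nonneg_of_le (fun n => by
      have := hb0 (n + 1); have := hM (n + 1); positivity) hterm hexp.summable
  refine ⟨fun n => b n / (n.factorial : ℝ), by simp [b], fun n => div_pos (hb0 n) (by positivity),
    fun n => by have := hb1 n; dsimp only; gcongr, fun k m => ?_, hsum, ?_⟩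
  · have h := hbsub k m
    have hc : ((k + m).choose k : ℝ) * (k.factorial * m.factorial) = (k + m).factorial := by
      have := Nat.add_choose_mul_factorial_mul_factorial k m
      rw [← mul_assoc, Nat.choose_symm_add]; exact_mod_cast this
    have h1 : (0 : ℝ) < k.factorial := by positivity
    have h2 : (0 : ℝ) < m.factorial := by positivity
    have h3 : (0 : ℝ) < (k + m).factorial := by positivity
    dsimp only
    rw [div_mul_div_comm, div_mul_eq_mul_div, div_le_div_iff₀ h3 (by positivity), mul_assoc, hc]
    gcongr
  · exact (hsum.tsum_le_tsum hterm hexp.summable).trans (hexp.tsum_eq.le.trans hεδ)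

theorem aux_weight {ι : Type*} [Fintype ι] (μ : ι → Measure ℝ)
    (hmom : ∀ i, HasAllMoments (μ i)) (δ : ℝ) (hδ : 0 < δ) :
    ∃ w : ℝ → ℝ, Measurable w ∧ (∀ x, 1 ≤ w x) ∧ (∀ x, w (-x) = w x) ∧
      (∀ x y, w (x + y) ≤ w x * w y) ∧ (∀ x y, |x| ≤ |y| → w x ≤ w y) ∧
      (∀ n : ℕ, ∃ c > 0, ∀ x, c * |x| ^ n ≤ w x) ∧
      ∀ i, Integrable (fun x => |x| * (w x - 1)) (μ i) ∧ ∫ x, |x| * (w x - 1) ∂(μ i) ≤ δ := by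
  let M : ℕ → ℝ := fun n => ∑ i, ∫ x, |x| ^ (n + 1) ∂(μ i)
  have hm0 : ∀ i n, 0 ≤ ∫ x, |x| ^ (n + 1) ∂(μ i) := fun i n =>
    integral_nonneg (fun x => by positivity)
  have hM : ∀ n, 0 ≤ M n := fun n => Finset.sum_nonneg (fun i _ => hm0 i n)
  have hmM : ∀ i n, ∫ x, |x| ^ (n + 1) ∂(μ i) ≤ M n := fun i n =>
    Finset.single_le_sum (f := fun i => ∫ x, |x| ^ (n + 1) ∂(μ i))
      (fun i _ => hm0 i n) (Finset.mem_univ i)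
  obtain ⟨a, ha0, hapos, hafac, hasub, hsm, hle⟩ := aux_coeff M hM δ hδ
  have hs : ∀ x : ℝ, Summable (fun n => a n * |x| ^ n) := fun x => by
    refine Summable.of_nonneg_of_le (fun n => by have := hapos n; positivity) (fun n => ?_)
      (Real.summable_pow_div_factorial |x|)
    calc a n * |x| ^ n ≤ 1 / (n.factorial : ℝ) * |x| ^ n := by gcongr; exact hafac n
      _ = _ := by ring
  let w : ℝ → ℝ := fun x => ∑' n, a n * |x| ^ n
  have hmono : ∀ x y, |x| ≤ |y| → w x ≤ w y := fun x y h =>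
    (hs x).tsum_le_tsum (fun n => by have := hapos n; gcongr) (hs y)
  have hge : ∀ n x, a n * |x| ^ n ≤ w x := fun n x =>
    (hs x).le_tsum n (fun m _ => by have := hapos m; positivity)
  have hw1 : ∀ x, w x - 1 = ∑' n, a (n + 1) * |x| ^ (n + 1) := fun x => by
    have := (hs x).tsum_eq_zero_add
    simp only [ha0, pow_zero, mul_one] at this
    change (∑' n, a n * |x| ^ n) - 1 = _
    rw [this]; ring
  have hmeas : Measurable w := by
    have h1 : Monotone (fun x => w (max x 0)) := fun x y hxy => hmono _ _ (by
      rw [abs_of_nonneg (le_max_right _ _), abs_of_nonneg (le_max_right _ _)]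
      exact max_le_max_right 0 hxy)
    have h2 : w = (fun x => w (max x 0)) ∘ (fun x => |x|) := by
      funext x; simp [w]
    rw [h2]
    exact h1.measurable.comp measurable_id.abs
  refine ⟨w, hmeas, fun x => by simpa [ha0] using hge 0 x, fun x => by simp [w], fun x y => ?_,
    hmono, fun n => ⟨a n, hapos n, hge n⟩, fun i => ?_⟩
  · have h1 : w (x + y) ≤ w (|x| + |y|) := hmono _ _ (by
      rw [abs_of_nonneg (by positivity : 0 ≤ |x| + |y|)]; exact abs_add_le x y)
    refine h1.trans ?_
    have hn : ∀ z : ℝ, Summable (fun n => ‖a n * |z| ^ n‖) := fun z => (hs z).norm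
    change _ ≤ (∑' n, a n * |x| ^ n) * (∑' n, a n * |y| ^ n)
    rw [tsum_mul_tsum_eq_tsum_sum_antidiagonal_of_summable_norm (hn x) (hn y)]
    refine (hs _).tsum_le_tsum (fun n => ?_)
      (summable_norm_sum_mul_antidiagonal_of_summable_norm (hn x) (hn y)).of_norm
    rw [abs_of_nonneg (by positivity : 0 ≤ |x| + |y|), (Commute.all |x| |y|).add_pow',
      Finset.mul_sum]
    refine Finset.sum_le_sum (fun p hp => ?_)
    obtain ⟨k, m⟩ := p
    rw [Finset.HasAntidiagonal.mem_antidiagonal] at hp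
    dsimp only at hp ⊢
    subst hp
    rw [nsmul_eq_mul]
    calc a (k + m) * (((k + m).choose k : ℝ) * (|x| ^ k * |y| ^ m))
        = a (k + m) * ((k + m).choose k : ℝ) * (|x| ^ k * |y| ^ m) := by ring
      _ ≤ a k * a m * (|x| ^ k * |y| ^ m) :=
          mul_le_mul_of_nonneg_right (hasub k m) (by positivity)
      _ = _ := by ring
  · have hF : ∀ n, Integrable (fun x : ℝ => a (n + 1) * |x| ^ (n + 1 + 1)) (μ i) := fun n =>
      (hmom i _).const_mul _
    have hnorm : ∀ n, ∫ x, ‖a (n + 1) * |x| ^ (n + 1 + 1)‖ ∂(μ i)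
        = a (n + 1) * ∫ x, |x| ^ (n + 1 + 1) ∂(μ i) := fun n => by
      rw [← integral_const_mul]
      congr 1; funext x
      have := hapos (n + 1)
      exact Real.norm_of_nonneg (by positivity)
    have hle' : ∀ n, a (n + 1) * ∫ x, |x| ^ (n + 1 + 1) ∂(μ i) ≤ a (n + 1) * M (n + 1) :=
      fun n => mul_le_mul_of_nonneg_left (hmM i _) (hapos _).le
    have hS : Summable (fun n => a (n + 1) * ∫ x, |x| ^ (n + 1 + 1) ∂(μ i)) :=
      Summable.of_nonneg_of_le (fun n => mul_nonneg (hapos _).le (hm0 i _)) hle' hsm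
    have hS' : Summable (fun n => ∫ x, ‖a (n + 1) * |x| ^ (n + 1 + 1)‖ ∂(μ i)) := by
      simpa only [hnorm] using hS
    have heq : (fun x => |x| * (w x - 1)) = fun x => ∑' n, a (n + 1) * |x| ^ (n + 1 + 1) := by
      funext x
      rw [hw1, ← tsum_mul_left]
      congr 1; funext n; ring
    rw [heq]
    refine ⟨?_, ?_⟩
    · have hF0 : ∀ n (x : ℝ), 0 ≤ a (n + 1) * |x| ^ (n + 1 + 1) := fun n x => by
        have := hapos (n + 1)
        positivity
      have hsx : ∀ x : ℝ, Summable (fun n => a (n + 1) * |x| ^ (n + 1 + 1)) := fun x => by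
        refine ((((summable_nat_add_iff 1).2 (hs x))).mul_left |x|).congr (fun n => ?_)
        ring
      refine ⟨?_, ?_⟩
      · rw [← heq]
        exact (measurable_id.abs.mul (hmeas.sub_const 1)).aestronglyMeasurable
      · rw [hasFiniteIntegral_iff_ofReal (ae_of_all _ fun x => tsum_nonneg fun n => hF0 n x)]
        have e : ∀ x : ℝ, ENNReal.ofReal (∑' n, a (n + 1) * |x| ^ (n + 1 + 1))
            = ∑' n, ENNReal.ofReal (a (n + 1) * |x| ^ (n + 1 + 1)) := fun x =>
          ENNReal.ofReal_tsum_of_nonneg (fun n => hF0 n x) (hsx x)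
        simp only [e]
        rw [lintegral_tsum (fun n => by fun_prop)]
        have e2 : ∀ n, ∫⁻ x, ENNReal.ofReal (a (n + 1) * |x| ^ (n + 1 + 1)) ∂(μ i)
            = ENNReal.ofReal (a (n + 1) * ∫ x, |x| ^ (n + 1 + 1) ∂(μ i)) := fun n => by
          rw [← integral_const_mul,
            ofReal_integral_eq_lintegral_ofReal (hF n) (ae_of_all _ fun x => hF0 n x)]
        simp only [e2]
        rw [← ENNReal.ofReal_tsum_of_nonneg
          (fun n => mul_nonneg (hapos _).le (hm0 i _)) hS]
        exact ENNReal.ofReal_lt_top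
    · have h := hasSum_integral_of_summable_integral_norm hF hS'
      simp only [integral_const_mul] at h
      rw [← h.tsum_eq]
      exact (hS.tsum_le_tsum hle' hsm).trans hle

theorem aux_conv (μ ζ : Measure ℝ) [IsProbabilityMeasure μ] [IsProbabilityMeasure ζ] (t : ℝ) :
    cdf (μ.conv ζ) t = ∫ x, cdf ζ (t - x) ∂μ := by
  rw [cdf_eq_real, measureReal_def, Measure.conv,
    Measure.map_apply (by fun_prop) measurableSet_Iic,
    Measure.prod_apply ((by fun_prop : Measurable fun p : ℝ × ℝ => p.1 + p.2) measurableSet_Iic)]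
  rw [← integral_toReal]
  · refine integral_congr_ae (ae_of_all _ fun x => ?_)
    simp only [cdf_eq_real, measureReal_def]
    congr 2
    ext y
    simp [le_sub_iff_add_le, add_comm]
  · exact (measurable_measure_prodMk_left
      ((by fun_prop : Measurable fun p : ℝ × ℝ => p.1 + p.2) measurableSet_Iic)).aemeasurable
  · exact ae_of_all _ fun x => measure_lt_top _ _

theorem aux_est (w f : ℝ → ℝ) (C : ℝ) (hC : 0 < C) (hf : ∀ x, f x = C * (w x)⁻¹)
    (hw1 : ∀ x, 1 ≤ w x) (hweven : ∀ x, w (-x) = w x)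
    (hsub : ∀ x y, w (x + y) ≤ w x * w y) (hmono : ∀ x y, |x| ≤ |y| → w x ≤ w y)
    (hfi : Integrable f) (ζ : Measure ℝ) [IsProbabilityMeasure ζ]
    (hζ : ζ = volume.withDensity (fun x => ENNReal.ofReal (f x)))
    (μ : Measure ℝ) [IsProbabilityMeasure μ] (hx : Integrable (fun x => x) μ) (δ : ℝ)
    (hwi : Integrable (fun x => |x| * (w x - 1)) μ) (hwδ : ∫ x, |x| * (w x - 1) ∂μ ≤ δ) (t : ℝ) :
    |cdf (μ.conv ζ) t - (cdf ζ t - f t * ∫ x, x ∂μ)| ≤ f t * δ := by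
  have hf0 : ∀ x, 0 < f x := fun x => by
    rw [hf]; have := hw1 x; positivity
  have hcdf : ∀ s, cdf ζ s = ∫ x in Set.Iic s, f x := fun s => by
    rw [cdf_eq_real, measureReal_def, hζ, withDensity_apply _ measurableSet_Iic,
      integral_eq_lintegral_of_nonneg_ae (ae_of_all _ fun x => (hf0 x).le)
        hfi.aestronglyMeasurable.restrict]
  have hdiff : ∀ u, |f (t - u) - f t| ≤ f t * (w u - 1) := fun u => by
    have h1 := hsub (t - u) u
    have h2 := hsub t (-u)
    rw [sub_add_cancel] at h1
    rw [hweven, ← sub_eq_add_neg] at h2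
    have a1 := hw1 t
    have a2 := hw1 (t - u)
    have a3 := hw1 u
    rw [hf, hf, ← mul_sub, abs_mul, abs_of_pos hC, mul_assoc]
    refine mul_le_mul_of_nonneg_left ?_ hC.le
    rw [inv_sub_inv (by positivity) (by positivity), abs_div, abs_of_pos (by positivity : 0 < w (t - u) * w t),
      inv_mul_eq_div, div_le_div_iff₀ (by positivity) (by positivity)]
    have : |w t - w (t - u)| ≤ w (t - u) * (w u - 1) := by
      rw [abs_le]
      constructor
      · rcases le_total (w (t - u)) (w t) with h | h <;> nlinarith
      · nlinarith
    nlinarith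
  have hR : ∀ x, |cdf ζ (t - x) - (cdf ζ t - f t * x)| ≤ f t * (|x| * (w x - 1)) := fun x => by
    have h1 : cdf ζ t - cdf ζ (t - x) = ∫ v in (t - x)..t, f v := by
      rw [hcdf, hcdf]
      exact intervalIntegral.integral_Iic_sub_Iic hfi.integrableOn hfi.integrableOn
    have h2 : ∫ v in (t - x)..t, (f v - f t) = (cdf ζ t - cdf ζ (t - x)) - x * f t := by
      rw [intervalIntegral.integral_sub hfi.intervalIntegrable (by simp), h1]
      simp
    have h3 := intervalIntegral.norm_integral_le_of_norm_le_const (a := t - x) (b := t)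
      (f := fun v => f v - f t) (C := f t * (w x - 1)) (fun v hv => by
        have h := hdiff (t - v)
        rw [sub_sub_cancel] at h
        refine h.trans (mul_le_mul_of_nonneg_left ?_ (hf0 t).le)
        have : w (t - v) ≤ w x := hmono _ _ (by
          rcases Set.mem_uIoc.1 hv with ⟨h1, h2⟩ | ⟨h1, h2⟩
          · rw [abs_of_nonneg (by linarith), abs_of_nonneg (by linarith)]; linarith
          · rw [abs_of_nonpos (by linarith), abs_of_nonpos (by linarith)]; linarith)
        linarith)
    rw [h2, sub_sub_cancel, Real.norm_eq_abs, abs_sub_comm] at h3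
    calc _ = |x * f t - (cdf ζ t - cdf ζ (t - x))| := by congr 1; ring
      _ ≤ _ := h3
      _ = _ := by ring
  have hcm : Integrable (fun x => cdf ζ (t - x)) μ := by
    refine Integrable.of_bound (C := 1) ?_ (ae_of_all _ fun x => ?_)
    · exact ((monotone_cdf ζ).measurable.comp (measurable_const.sub measurable_id)).aestronglyMeasurable
    · rw [Real.norm_of_nonneg (cdf_nonneg _ _)]; exact cdf_le_one _ _
  have hlin : Integrable (fun x => cdf ζ t - f t * x) μ :=
    (integrable_const _).sub (hx.const_mul _)
  have e1 : ∫ x, (cdf ζ t - f t * x) ∂μ = cdf ζ t - f t * ∫ x, x ∂μ := by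
    rw [integral_sub (integrable_const _) (hx.const_mul _), integral_const_mul]
    simp
  rw [aux_conv, ← e1, ← integral_sub hcm hlin]
  calc _ ≤ ∫ x, |cdf ζ (t - x) - (cdf ζ t - f t * x)| ∂μ := abs_integral_le_integral_abs
    _ ≤ ∫ x, f t * (|x| * (w x - 1)) ∂μ :=
        integral_mono (hcm.sub hlin).abs (hwi.const_mul _) hR
    _ = f t * ∫ x, (|x| * (w x - 1)) ∂μ := integral_const_mul _ _
    _ ≤ _ := mul_le_mul_of_nonneg_left hwδ (hf0 t).le

theorem stmt_10 (T : Type*) [Fintype T] [Nonempty T] (μ : T → T → Measure ℝ)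
    (hprob : ∀ t s, IsProbabilityMeasure (μ t s)) (hmom : ∀ t s, HasAllMoments (μ t s))
    (hmean : ∀ t s : T, s ≠ t → (∫ x, x ∂(μ t s)) < ∫ x, x ∂(μ t t)) :
    ∃ ζ : Measure ℝ, IsProbabilityMeasure ζ ∧ HasAllMoments ζ ∧ (∫ x, x ∂ζ) = 0 ∧
      ∀ t s : T, s ≠ t → StrictFSD ((μ t t).conv ζ) ((μ t s).conv ζ) := by
  classical
  obtain ⟨δ, hδ, hδle⟩ : ∃ δ : ℝ, 0 < δ ∧ ∀ t s : T, s ≠ t →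
      3 * δ ≤ (∫ x, x ∂(μ t t)) - ∫ x, x ∂(μ t s) := by
    let g : T × T → ℝ := fun p => if p.2 = p.1 then 1 else
      ((∫ x, x ∂(μ p.1 p.1)) - ∫ x, x ∂(μ p.1 p.2)) / 3
    obtain ⟨p, hp⟩ := Finite.exists_min g
    refine ⟨g p, ?_, fun t s hst => ?_⟩
    · by_cases h : p.2 = p.1
      · simp [g, h]
      · have := hmean p.1 p.2 h
        simp only [g, h, if_false]
        linarith
    · have := hp (t, s)
      have e : g (t, s) = ((∫ x, x ∂(μ t t)) - ∫ x, x ∂(μ t s)) / 3 := by simp [g, hst]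
      linarith
  obtain ⟨w, hwm, hw1, hweven, hsub, hmono, hgrow, hwμ⟩ :=
    aux_weight (fun p : T × T => μ p.1 p.2) (fun p => hmom p.1 p.2) δ hδ
  have hw0 : ∀ x, 0 < w x := fun x => by linarith [hw1 x]
  have hmomw : ∀ n : ℕ, Integrable (fun x : ℝ => |x| ^ n * (w x)⁻¹) := fun n => by
    obtain ⟨c, hc, h1⟩ := hgrow n
    obtain ⟨d, hd, h2⟩ := hgrow (n + 2)
    refine (integrable_inv_one_add_sq.const_mul (c⁻¹ + d⁻¹)).mono'
      (by fun_prop) (ae_of_all _ fun x => ?_)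
    have hx := hw0 x
    rw [Real.norm_of_nonneg (by positivity), ← div_eq_mul_inv, ← div_eq_mul_inv,
      div_le_div_iff₀ hx (by positivity)]
    have e1 : |x| ^ n ≤ c⁻¹ * w x := by
      rw [inv_mul_eq_div, le_div_iff₀ hc]; linarith [h1 x]
    have e2 : |x| ^ (n + 2) ≤ d⁻¹ * w x := by
      rw [inv_mul_eq_div, le_div_iff₀ hd]; linarith [h2 x]
    rw [pow_add, sq_abs] at e2
    linarith
  have hfi0 : Integrable (fun x : ℝ => (w x)⁻¹) := by simpa using hmomw 0
  have hpos : 0 < ∫ x, (w x)⁻¹ := by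
    rw [integral_pos_iff_support_of_nonneg (fun x => (inv_pos.2 (hw0 x)).le) hfi0]
    have : Function.support (fun x : ℝ => (w x)⁻¹) = Set.univ := by
      ext x; simp [(hw0 x).ne']
    rw [this]; simp
  let C : ℝ := (∫ x, (w x)⁻¹)⁻¹
  have hC : 0 < C := inv_pos.2 hpos
  let f : ℝ → ℝ := fun x => C * (w x)⁻¹
  have hfm : Measurable f := by fun_prop
  have hf0 : ∀ x, 0 < f x := fun x => mul_pos hC (inv_pos.2 (hw0 x))
  have hfi : Integrable f := hfi0.const_mul C
  have hf1 : ∫ x, f x = 1 := by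
    rw [integral_const_mul]; exact inv_mul_cancel₀ hpos.ne'
  let ζ : Measure ℝ := volume.withDensity (fun x => ENNReal.ofReal (f x))
  have hζp : IsProbabilityMeasure ζ := ⟨by
    rw [withDensity_apply _ MeasurableSet.univ, Measure.restrict_univ,
      ← ofReal_integral_eq_lintegral_ofReal hfi (ae_of_all _ fun x => (hf0 x).le), hf1]
    simp⟩
  refine ⟨ζ, hζp, fun n => ?_, ?_, fun t s hst => ?_⟩
  · rw [integrable_withDensity_iff (by fun_prop) (ae_of_all _ fun x => ENNReal.ofReal_lt_top)]
    refine ((hmomw n).const_mul C).congr (ae_of_all _ fun x => ?_)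
    simp only [ENNReal.toReal_ofReal (hf0 x).le, f]
    ring
  · rw [integral_withDensity_eq_integral_toReal_smul (by fun_prop)
      (ae_of_all _ fun x => ENNReal.ofReal_lt_top)]
    have h := integral_neg_eq_self (fun x => (ENNReal.ofReal (f x)).toReal • x) volume
    simp only [f, hweven, smul_eq_mul, mul_neg, integral_neg] at h ⊢
    linarith
  · have hxi : ∀ t s, Integrable (fun x => x) (μ t s) := fun t s => by
      have := hmom t s 1
      simp only [pow_one] at this
      exact (integrable_norm_iff (by fun_prop)).1 this
    have key : ∀ t s u, |cdf ((μ t s).conv ζ) u - (cdf ζ u - f u * ∫ x, x ∂(μ t s))| ≤ f u * δ :=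
      fun t s u => aux_est w f C hC (fun _ => rfl) hw1 hweven hsub hmono hfi ζ rfl (μ t s)
        (hxi t s) δ (hwμ (t, s)).1 (hwμ (t, s)).2 u
    have hlt : ∀ u, cdf ((μ t t).conv ζ) u < cdf ((μ t s).conv ζ) u := fun u => by
      have h1 := (abs_le.1 (key t t u)).2
      have h2 := (abs_le.1 (key t s u)).1
      have h3 := mul_le_mul_of_nonneg_left (hδle t s hst) (hf0 u).le
      have h4 := mul_pos (hf0 u) hδ
      linarith
    refine ⟨fun u => (hlt u).le, fun h => ?_⟩
    have := hlt 0
    rw [h] at this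
    exact lt_irrefl _ this
end
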